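/- arXiv:1312.4674 — 8 statements merged into one kernel-verified Lean document; each statement's English description precedes it below -/
import Mathlib

section
/- Let θ > 0, κ > 0, α > 2, β > 2, and set ϱ = (β−2)κ. Let 𝔭(x) = (1/(x·B(α/2, β/2)))·(αx/(αx+ϱ))^{α/2}·(ϱ/(αx+ϱ))^{β/2} for x ∈ (0,∞). Then 𝔭 solves the stationary Fokker–Planck (Kolmogorov forward) equation of the Fisher–Snedecor diffusion: for every x ∈ (0,∞), the derivative d/dx [σ²(x)·𝔭(x)] exists and equals 2·a(x)·𝔭(x). -/
open Real MeasureTheory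

/-- Drift of the Fisher–Snedecor diffusion: `a(x) = -θ(x - κ)`. -/
noncomputable def fsDrift (θ κ : ℝ) (x : ℝ) : ℝ := -θ * (x - κ)

/-- Squared diffusion coefficient: `σ²(x) = 2θx(2x/(β-2) + 2κ/α)`. -/
noncomputable def fsSigma2 (θ κ α β : ℝ) (x : ℝ) : ℝ :=
  2 * θ * x * (2 * x / (β - 2) + 2 * κ / α)

/-- The real Beta function `B(a,b) = Γ(a)Γ(b)/Γ(a+b)`. -/
noncomputable def realBeta (a b : ℝ) : ℝ :=
  Real.Gamma a * Real.Gamma b / Real.Gamma (a + b)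

/-- The candidate invariant density
`𝔭(x) = (1/(x B(α/2,β/2))) (αx/(αx+ϱ))^{α/2} (ϱ/(αx+ϱ))^{β/2}`. -/
noncomputable def fsDensity (α β ϱ : ℝ) (x : ℝ) : ℝ :=
  1 / (x * realBeta (α / 2) (β / 2)) * (α * x / (α * x + ϱ)) ^ (α / 2) *
    (ϱ / (α * x + ϱ)) ^ (β / 2)

/-- A positive function with logarithmic derivative `l` keeps this form under real powers. -/
lemma HasDerivAt.rpow_const_of_log_deriv {f : ℝ → ℝ} {l p x : ℝ}
    (hf : HasDerivAt f (f x * l) x) (hx : 0 < f x) :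
    HasDerivAt (fun y => f y ^ p) (f x ^ p * (p * l)) x := by
  convert hf.rpow_const (p := p) (Or.inl hx.ne') using 1
  rw [Real.rpow_sub_one hx.ne']
  field_simp

/-- The logarithmic derivative of the Fisher–Snedecor density. -/
lemma hasDerivAt_fsDensity {α β ϱ x : ℝ} (hα : 0 < α) (hϱ : 0 < ϱ) (hx : 0 < x) :
    HasDerivAt (fsDensity α β ϱ)
      (fsDensity α β ϱ x *
        (-1 / x + α / 2 * (ϱ / (x * (α * x + ϱ))) + β / 2 * (-α / (α * x + ϱ)))) x := by
  have hs : 0 < α * x + ϱ := by positivity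
  have hlin : HasDerivAt (fun y : ℝ => α * y) α x := by
    simpa using (hasDerivAt_id x).const_mul α
  have hden : HasDerivAt (fun y : ℝ => α * y + ϱ) α x := hlin.add_const ϱ
  have hu : HasDerivAt (fun y : ℝ => α * y / (α * y + ϱ))
      (α * x / (α * x + ϱ) * (ϱ / (x * (α * x + ϱ)))) x := by
    refine (hlin.div hden hs.ne').congr_deriv ?_
    field_simp
    ring
  have hv : HasDerivAt (fun y : ℝ => ϱ / (α * y + ϱ))
      (ϱ / (α * x + ϱ) * (-α / (α * x + ϱ))) x := by
    refine ((hasDerivAt_const x ϱ).div hden hs.ne').congr_deriv ?_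
    field_simp
    ring
  have hc : HasDerivAt (fun y : ℝ => 1 / (y * realBeta (α / 2) (β / 2)))
      (1 / (x * realBeta (α / 2) (β / 2)) * (-1 / x)) x := by
    have h := (hasDerivAt_inv hx.ne').mul_const (realBeta (α / 2) (β / 2))⁻¹
    simp only [one_div, mul_inv]
    refine h.congr_deriv ?_
    field_simp
  have hup := hu.rpow_const_of_log_deriv (p := α / 2) (by positivity)
  have hvp := hv.rpow_const_of_log_deriv (p := β / 2) (by positivity)
  refine ((hc.mul hup).mul hvp).congr_deriv ?_
  simp only [fsDensity, Pi.mul_apply]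
  ring

lemma hasDerivAt_fsSigma2 (θ κ α β x : ℝ) :
    HasDerivAt (fsSigma2 θ κ α β)
      (2 * θ * (2 * x / (β - 2) + 2 * κ / α) + 2 * θ * x * (2 / (β - 2))) x := by
  have h₁ : HasDerivAt (fun y : ℝ => 2 * θ * y) (2 * θ) x := by
    simpa using (hasDerivAt_id x).const_mul (2 * θ)
  have h₂ : HasDerivAt (fun y : ℝ => 2 * y / (β - 2) + 2 * κ / α) (2 / (β - 2)) x := by
    simpa using (((hasDerivAt_id x).const_mul 2).div_const (β - 2)).add_const (2 * κ / α)
  exact h₁.mul h₂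

/-- with `ϱ = (β-2)κ`, the density `𝔭` solves the stationary
Fokker–Planck equation: for every `x > 0`, the derivative of `σ²·𝔭` at `x`
exists and equals `2·a(x)·𝔭(x)`. -/
theorem fs_density_solves_stationary_fokker_planck
    (θ κ α β : ℝ) (hθ : 0 < θ) (hκ : 0 < κ) (hα : 2 < α) (hβ : 2 < β) :
    ∀ x ∈ Set.Ioi (0 : ℝ),
      HasDerivAt (fun y : ℝ => fsSigma2 θ κ α β y * fsDensity α β ((β - 2) * κ) y)
        (2 * fsDrift θ κ x * fsDensity α β ((β - 2) * κ) x) x := by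
  intro x hx
  have hx : 0 < x := hx
  have hα' : 0 < α := by linarith
  have hβ' : 0 < β - 2 := by linarith
  have hϱ : 0 < (β - 2) * κ := mul_pos hβ' hκ
  have hs : 0 < α * x + (β - 2) * κ := by positivity
  refine ((hasDerivAt_fsSigma2 θ κ α β x).mul
    (hasDerivAt_fsDensity (β := β) hα' hϱ hx)).congr_deriv ?_
  simp only [fsSigma2, fsDrift]
  field_simp
  ring
end

section
/- For all parameters α > 0, β > 0, ϱ > 0, the function 𝔭(x) = (1/(x·B(α/2, β/2)))·(αx/(αx+ϱ))^{α/2}·(ϱ/(αx+ϱ))^{β/2} is a probability density on (0,∞): it is nonnegative and ∫₀^∞ 𝔭(x) dx = 1. -/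
open Real MeasureTheory

open ProbabilityTheory in
/-- The density of the beta distribution integrates to `1` over the unit interval. -/
theorem setIntegral_Ioo_betaPDFReal {a b : ℝ} (ha : 0 < a) (hb : 0 < b) :
    ∫ u in Set.Ioo (0 : ℝ) 1, betaPDFReal a b u = 1 := by
  have hnonneg : ∀ u ∈ Set.Ioo (0 : ℝ) 1, 0 ≤ betaPDFReal a b u :=
    fun u hu => (betaPDFReal_pos hu.1 hu.2 ha hb).le
  have hlint : ∫⁻ u in Set.Ioo (0 : ℝ) 1, ENNReal.ofReal (betaPDFReal a b u) = 1 := by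
    rw [← lintegral_betaPDF_eq_one ha hb, lintegral_betaPDF]
    exact setLIntegral_congr_fun measurableSet_Ioo
      (fun u hu => betaPDF_of_pos_lt_one hu.1 hu.2)
  rw [integral_eq_lintegral_of_nonneg_ae
    ((ae_restrict_iff' measurableSet_Ioo).2 (Filter.Eventually.of_forall hnonneg))
    (stronglyMeasurable_betaPDFReal a b).aestronglyMeasurable, hlint, ENNReal.toReal_one]

/-- The map `x ↦ c x / (c x + r)` sends `(0,∞)` onto `(0,1)`. -/
theorem image_mul_div_mul_add_Ioi {c r : ℝ} (hc : 0 < c) (hr : 0 < r) :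
    (fun x => c * x / (c * x + r)) '' Set.Ioi 0 = Set.Ioo 0 1 := by
  ext u
  constructor
  · rintro ⟨x, hx : 0 < x, rfl⟩
    have hcx : 0 < c * x := mul_pos hc hx
    exact ⟨by positivity, (div_lt_one (by positivity)).2 (by linarith)⟩
  · rintro ⟨hu0, hu1⟩
    have hu : 0 < 1 - u := sub_pos.2 hu1
    refine ⟨r * u / (c * (1 - u)), Set.mem_Ioi.2 (by positivity), ?_⟩
    have hcx : c * (r * u / (c * (1 - u))) = r * u / (1 - u) := by field_simp
    have hden : r * u / (1 - u) + r = r / (1 - u) := by field_simp; ring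
    simp only [hcx, hden]
    field_simp

/-- The map `x ↦ c x / (c x + r)` is injective on `(0,∞)`. -/
theorem injOn_mul_div_mul_add_Ioi {c r : ℝ} (hc : 0 < c) (hr : 0 < r) :
    Set.InjOn (fun x => c * x / (c * x + r)) (Set.Ioi 0) := by
  intro x (hx : 0 < x) y (hy : 0 < y) hxy
  have hx' : c * x + r ≠ 0 := by positivity
  have hy' : c * y + r ≠ 0 := by positivity
  rw [div_eq_div_iff hx' hy'] at hxy
  exact mul_left_cancel₀ (mul_pos hc hr).ne' (by linarith)

theorem hasDerivAt_mul_div_mul_add {c r x : ℝ} (hx : c * x + r ≠ 0) :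
    HasDerivAt (fun x => c * x / (c * x + r)) (c * r / (c * x + r) ^ 2) x := by
  have h : HasDerivAt (fun x => c * x) c x := by
    simpa using (hasDerivAt_id x).const_mul c
  exact (h.div (h.add_const r) hx).congr_deriv (by ring)

/-- On `(0,∞)`, `fsDensity` is the pullback of a beta density along
`x ↦ α x / (α x + ϱ)`. -/
theorem fsDensity_eq_deriv_mul_betaPDFReal {α β ϱ x : ℝ} (hα : 0 < α) (hϱ : 0 < ϱ)
    (hx : 0 < x) :
    fsDensity α β ϱ x = α * ϱ / (α * x + ϱ) ^ 2 *
      ProbabilityTheory.betaPDFReal (α / 2) (β / 2) (α * x / (α * x + ϱ)) := by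
  have hd : 0 < α * x + ϱ := by positivity
  have hu0 : 0 < α * x / (α * x + ϱ) := by positivity
  have hu1 : α * x / (α * x + ϱ) < 1 := (div_lt_one hd).2 (by linarith)
  have hcompl : 1 - α * x / (α * x + ϱ) = ϱ / (α * x + ϱ) := by field_simp; ring
  have hv0 : 0 < ϱ / (α * x + ϱ) := by positivity
  rw [ProbabilityTheory.betaPDFReal, if_pos ⟨hu0, hu1⟩, hcompl, rpow_sub_one hu0.ne',
    rpow_sub_one hv0.ne', fsDensity]
  change _ = _ * (1 / realBeta (α / 2) (β / 2) * _ * _)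
  generalize (α * x / (α * x + ϱ)) ^ (α / 2) = p
  generalize (ϱ / (α * x + ϱ)) ^ (β / 2) = q
  field_simp

/-- for all `α, β, ϱ > 0`, `𝔭` is a probability density on `(0,∞)`:
it is nonnegative there and integrates to `1`. -/
theorem fs_density_is_probability_density
    (α β ϱ : ℝ) (hα : 0 < α) (hβ : 0 < β) (hϱ : 0 < ϱ) :
    (∀ x ∈ Set.Ioi (0 : ℝ), 0 ≤ fsDensity α β ϱ x) ∧
      (∫ x in Set.Ioi (0 : ℝ), fsDensity α β ϱ x) = 1 := by
  have hα' : 0 < α / 2 := half_pos hα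
  have hβ' : 0 < β / 2 := half_pos hβ
  constructor
  · intro x (hx : 0 < x)
    have hB : 0 < realBeta (α / 2) (β / 2) := ProbabilityTheory.beta_pos hα' hβ'
    unfold fsDensity
    positivity
  · rw [← setIntegral_Ioo_betaPDFReal hα' hβ', ← image_mul_div_mul_add_Ioi hα hϱ,
      integral_image_eq_integral_abs_deriv_smul measurableSet_Ioi
        (fun x (hx : 0 < x) =>
          (hasDerivAt_mul_div_mul_add (by positivity)).hasDerivWithinAt)
        (injOn_mul_div_mul_add_Ioi hα hϱ)]
    refine setIntegral_congr_fun measurableSet_Ioi fun x (hx : 0 < x) => ?_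
    have hderiv : 0 ≤ α * ϱ / (α * x + ϱ) ^ 2 := by positivity
    simp only [abs_of_nonneg hderiv, smul_eq_mul]
    exact fsDensity_eq_deriv_mul_betaPDFReal hα hϱ hx
end

section
/- Let α > 0, β > 0, ϱ > 0 and let 𝔭(x) = (1/(x·B(α/2, β/2)))·(αx/(αx+ϱ))^{α/2}·(ϱ/(αx+ϱ))^{β/2} for x ∈ (0,∞). Then for every real υ, the function x ↦ x^{υ}·𝔭(x) is integrable over (0,∞) if and only if −α/2 < υ < β/2. In particular, ∫₀^∞ x^{−γ} 𝔭(x) dx < ∞ if and only if γ < α/2, and ∫₀^∞ x^{δ} 𝔭(x) dx < ∞ if and only if δ < β/2. -/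
open Real MeasureTheory

theorem integrable_mul_iff_of_bounds {X : Type*} [MeasurableSpace X]
    {μ : Measure X} {f g : X → ℝ} {m M : ℝ} (hm : 0 < m)
    (hf : AEStronglyMeasurable f μ) (hg : AEStronglyMeasurable g μ)
    (hfg : ∀ᵐ x ∂μ, m ≤ g x ∧ g x ≤ M) :
    Integrable (fun x => f x * g x) μ ↔ Integrable f μ := by
  constructor
  · intro h
    refine (h.norm.const_mul m⁻¹).mono' hf ?_
    filter_upwards [hfg] with x hx
    rw [norm_mul, Real.norm_of_nonneg (hm.le.trans hx.1), inv_mul_eq_div, le_div_iff₀ hm]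
    exact mul_le_mul_of_nonneg_left hx.1 (norm_nonneg _)
  · intro h
    refine (h.norm.mul_const M).mono' (hf.mul hg) ?_
    filter_upwards [hfg] with x hx
    rw [norm_mul, Real.norm_of_nonneg (hm.le.trans hx.1)]
    exact mul_le_mul_of_nonneg_left hx.2 (norm_nonneg _)

theorem integrableOn_Ioo_rpow_mul_affine_rpow_neg_iff {a b p s : ℝ} (ha : 0 < a) (hb : 0 < b)
    (hp : 0 ≤ p) :
    IntegrableOn (fun x : ℝ => x ^ s * (a * x + b) ^ (-p)) (Set.Ioo 0 1) ↔ -1 < s := by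
  rw [← intervalIntegral.integrableOn_Ioo_rpow_iff (zero_lt_one' ℝ)]
  refine integrable_mul_iff_of_bounds (m := (a + b) ^ (-p)) (M := b ^ (-p))
    (by positivity) (by fun_prop) (Measurable.aestronglyMeasurable (by fun_prop)) ?_
  filter_upwards [ae_restrict_mem measurableSet_Ioo] with x hx
  have hax : 0 < a * x := mul_pos ha hx.1
  exact ⟨Real.rpow_le_rpow_of_nonpos (by positivity) (by nlinarith [hx.2]) (by linarith),
    Real.rpow_le_rpow_of_nonpos hb (by linarith) (by linarith)⟩

theorem integrableOn_Ioi_one_rpow_mul_affine_rpow_neg_iff {a b p s : ℝ} (ha : 0 < a) (hb : 0 < b)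
    (hp : 0 ≤ p) :
    IntegrableOn (fun x : ℝ => x ^ s * (a * x + b) ^ (-p)) (Set.Ioi 1) ↔ s - p < -1 := by
  have factor : Set.EqOn (fun x : ℝ => x ^ s * (a * x + b) ^ (-p))
      (fun x => x ^ (s - p) * (a + b / x) ^ (-p)) (Set.Ioi 1) := by
    intro x hx
    have hx0 : 0 < x := zero_lt_one.trans hx
    have hsplit : a * x + b = x * (a + b / x) := by field_simp
    simp only
    rw [hsplit, Real.mul_rpow hx0.le (by positivity), ← mul_assoc, ← Real.rpow_add hx0,
      ← sub_eq_add_neg]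
  rw [integrableOn_congr_fun factor measurableSet_Ioi,
    ← integrableOn_Ioi_rpow_iff (zero_lt_one' ℝ)]
  refine integrable_mul_iff_of_bounds (m := (a + b) ^ (-p)) (M := a ^ (-p))
    (by positivity) (by fun_prop) (Measurable.aestronglyMeasurable (by fun_prop)) ?_
  filter_upwards [ae_restrict_mem measurableSet_Ioi] with x hx
  have hx0 : 0 < x := zero_lt_one.trans hx
  have hbx : 0 < b / x := by positivity
  have hbx' : b / x ≤ b := div_le_self hb.le (le_of_lt hx)
  exact ⟨Real.rpow_le_rpow_of_nonpos (by positivity) (by linarith) (by linarith),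
    Real.rpow_le_rpow_of_nonpos ha (by linarith) (by linarith)⟩

theorem integrableOn_Ioi_zero_rpow_mul_affine_rpow_neg_iff {a b p s : ℝ} (ha : 0 < a) (hb : 0 < b)
    (hp : 0 ≤ p) :
    IntegrableOn (fun x : ℝ => x ^ s * (a * x + b) ^ (-p)) (Set.Ioi 0) ↔
      -1 < s ∧ s - p < -1 := by
  rw [← Set.Ioc_union_Ioi_eq_Ioi (zero_le_one' ℝ), integrableOn_union,
    integrableOn_Ioc_iff_integrableOn_Ioo,
    integrableOn_Ioo_rpow_mul_affine_rpow_neg_iff ha hb hp,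
    integrableOn_Ioi_one_rpow_mul_affine_rpow_neg_iff ha hb hp]

theorem realBeta_pos {a b : ℝ} (ha : 0 < a) (hb : 0 < b) : 0 < realBeta a b :=
  div_pos (mul_pos (Real.Gamma_pos_of_pos ha) (Real.Gamma_pos_of_pos hb))
    (Real.Gamma_pos_of_pos (add_pos ha hb))

theorem rpow_mul_fsDensity_eq {α β ϱ x : ℝ} (hα : 0 < α) (hϱ : 0 < ϱ) (hx : 0 < x) (υ : ℝ) :
    x ^ υ * fsDensity α β ϱ x =
      (α ^ (α / 2) * ϱ ^ (β / 2) / realBeta (α / 2) (β / 2)) *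
        (x ^ (υ - 1 + α / 2) * (α * x + ϱ) ^ (-(α / 2 + β / 2))) := by
  have hd : 0 < α * x + ϱ := by positivity
  rw [fsDensity, Real.div_rpow (by positivity) hd.le, Real.div_rpow hϱ.le hd.le,
    Real.mul_rpow hα.le hx.le, Real.rpow_add hx, Real.rpow_sub_one hx.ne',
    Real.rpow_neg hd.le, Real.rpow_add hd]
  simp only [div_eq_mul_inv, mul_inv, one_mul]
  ring

theorem integrableOn_rpow_mul_fsDensity_iff {α β ϱ : ℝ} (hα : 0 < α) (hβ : 0 < β) (hϱ : 0 < ϱ)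
    (υ : ℝ) :
    IntegrableOn (fun x : ℝ => x ^ υ * fsDensity α β ϱ x) (Set.Ioi 0) ↔
      -(α / 2) < υ ∧ υ < β / 2 := by
  have hB := realBeta_pos (half_pos hα) (half_pos hβ)
  have hC : α ^ (α / 2) * ϱ ^ (β / 2) / realBeta (α / 2) (β / 2) ≠ 0 := by positivity
  have hcongr := fun (x : ℝ) (hx : x ∈ Set.Ioi 0) => rpow_mul_fsDensity_eq (β := β) hα hϱ hx υ
  rw [integrableOn_congr_fun hcongr measurableSet_Ioi, IntegrableOn, integrable_const_mul_iff hC.isUnit, ← IntegrableOn,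
    integrableOn_Ioi_zero_rpow_mul_affine_rpow_neg_iff hα hϱ (by positivity)]
  constructor <;> rintro ⟨h₁, h₂⟩ <;> constructor <;> linarith

/-- for every real `υ`, `x ↦ x^υ 𝔭(x)` is integrable on `(0,∞)`
iff `-α/2 < υ < β/2`.  In particular (for nonnegative exponents `γ, δ`),
`∫₀^∞ x^{-γ} 𝔭(x) dx < ∞` iff `γ < α/2`, and
`∫₀^∞ x^{δ} 𝔭(x) dx < ∞` iff `δ < β/2`. -/
theorem fs_density_moment_integrability
    (α β ϱ : ℝ) (hα : 0 < α) (hβ : 0 < β) (hϱ : 0 < ϱ) :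
    (∀ υ : ℝ,
      IntegrableOn (fun x : ℝ => x ^ υ * fsDensity α β ϱ x) (Set.Ioi 0) ↔
        (-(α / 2) < υ ∧ υ < β / 2)) ∧
    (∀ γ : ℝ, 0 ≤ γ →
      (IntegrableOn (fun x : ℝ => x ^ (-γ) * fsDensity α β ϱ x) (Set.Ioi 0) ↔
        γ < α / 2)) ∧
    (∀ δ : ℝ, 0 ≤ δ →
      (IntegrableOn (fun x : ℝ => x ^ δ * fsDensity α β ϱ x) (Set.Ioi 0) ↔
        δ < β / 2)) := by
  refine ⟨integrableOn_rpow_mul_fsDensity_iff hα hβ hϱ, fun γ hγ => ?_, fun δ hδ => ?_⟩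
  · rw [integrableOn_rpow_mul_fsDensity_iff hα hβ hϱ, neg_lt_neg_iff]
    exact and_iff_left (by linarith)
  · rw [integrableOn_rpow_mul_fsDensity_iff hα hβ hϱ]
    exact and_iff_right (by linarith)
end

section
/- Let θ > 0, κ > 0, α > 2, β > 2 and set b = κ(β−2)/α and s(y) = y^{−α/2}·(y + b)^{α/2+β/2−1} for y ∈ (0,∞). Then for every x ∈ (0,∞), both ∫₀^x s(y) dy = ∞ and ∫_x^∞ s(y) dy = ∞. (Hence, by Feller's test, both boundary points 0 and ∞ are unattainable for the Fisher–Snedecor diffusion.) -/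
open Real MeasureTheory

/-- If `f` is bounded below on `s` by a positive multiple of a nonnegative measurable function that
is not integrable on `s`, then the Lebesgue integral of `f` over `s` is infinite. -/
theorem setLIntegral_ofReal_eq_top_of_const_mul_le {s : Set ℝ} {f g : ℝ → ℝ} {c : ℝ}
    (hs : MeasurableSet s) (hg : Measurable g) (hg0 : ∀ y ∈ s, 0 ≤ g y)
    (hgi : ¬ IntegrableOn g s) (hc : 0 < c) (hle : ∀ y ∈ s, c * g y ≤ f y) :
    ∫⁻ y in s, ENNReal.ofReal (f y) = ⊤ := by
  have hcg : ¬ IntegrableOn (fun y => c * g y) s := fun h =>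
    hgi ((integrable_const_mul_iff (isUnit_iff_ne_zero.mpr hc.ne') g).mp h)
  have htop : ∫⁻ y in s, ENNReal.ofReal (c * g y) = ⊤ := by
    by_contra h
    refine hcg ⟨(hg.const_mul c).aestronglyMeasurable, ?_⟩
    rw [hasFiniteIntegral_iff_ofReal]
    · exact lt_top_iff_ne_top.mpr h
    · filter_upwards [ae_restrict_mem hs] with y hy
      exact mul_nonneg hc.le (hg0 y hy)
  rw [eq_top_iff, ← htop]
  exact setLIntegral_mono' hs fun y hy => ENNReal.ofReal_le_ofReal (hle y hy)

/-- with `b = κ(β-2)/α` and `s(y) = y^{-α/2} (y+b)^{α/2+β/2-1}`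
(the scale density of the Fisher–Snedecor diffusion up to a constant), for
every `x > 0` both `∫₀^x s(y) dy = ∞` and `∫_x^∞ s(y) dy = ∞`. -/
theorem fs_scale_density_nonintegrable_at_boundaries
    (θ κ α β : ℝ) (hθ : 0 < θ) (hκ : 0 < κ) (hα : 2 < α) (hβ : 2 < β) :
    ∀ x ∈ Set.Ioi (0 : ℝ),
      (∫⁻ y in Set.Ioo (0 : ℝ) x,
          ENNReal.ofReal
            (y ^ (-(α / 2)) * (y + κ * (β - 2) / α) ^ (α / 2 + β / 2 - 1)) = ⊤) ∧
      (∫⁻ y in Set.Ioi x,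
          ENNReal.ofReal
            (y ^ (-(α / 2)) * (y + κ * (β - 2) / α) ^ (α / 2 + β / 2 - 1)) = ⊤) := by
  intro x hx
  have hx : 0 < x := hx
  have hb : 0 < κ * (β - 2) / α := by
    have : 0 < β - 2 := by linarith
    positivity
  have hγ : 0 ≤ α / 2 + β / 2 - 1 := by linarith
  constructor
  · refine setLIntegral_ofReal_eq_top_of_const_mul_le (g := fun y => y ^ (-(α / 2)))
      measurableSet_Ioo (by fun_prop) (fun y hy => rpow_nonneg hy.1.le _) ?_
      (rpow_pos_of_pos hb (α / 2 + β / 2 - 1)) fun y hy => ?_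
    · rw [intervalIntegral.integrableOn_Ioo_rpow_iff hx]
      linarith
    · have hy0 : 0 < y := hy.1
      rw [mul_comm]
      gcongr
      linarith
  · refine setLIntegral_ofReal_eq_top_of_const_mul_le (g := fun y => y ^ (β / 2 - 1))
      measurableSet_Ioi (by fun_prop) (fun y hy => rpow_nonneg (hx.trans hy).le _) ?_
      one_pos fun y hy => ?_
    · rw [integrableOn_Ioi_rpow_iff hx]
      linarith
    · have hy0 : 0 < y := hx.trans hy
      calc 1 * y ^ (β / 2 - 1) = y ^ (-(α / 2)) * y ^ (α / 2 + β / 2 - 1) := by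
            rw [one_mul, ← rpow_add hy0]
            ring_nf
        _ ≤ _ := by
            gcongr
            linarith
end

section
/- (Lyapunov-type condition, Proposition 3.1(1).) Let θ > 0, κ > 0, α > 2, β > 2, and let φ be of standard Lyapunov form with exponents γ, δ satisfying 0 < γ < α/2 − 1 and 0 < δ < β/2. Then there exist 0 < u < v < ∞ and positive constants c, C such that for all x ∈ (0,∞): (Lφ)(x) ≤ −c·φ(x) + C·𝟙_{[u,v]}(x). -/
open Real MeasureTheory

/-- Formal generator of the Fisher–Snedecor diffusion:
`(Lf)(x) = a(x) f'(x) + (1/2) σ²(x) f''(x)`. -/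
noncomputable def fsGen (θ κ α β : ℝ) (f : ℝ → ℝ) (x : ℝ) : ℝ :=
  fsDrift θ κ x * deriv f x + (1 / 2) * fsSigma2 θ κ α β x * deriv (deriv f) x

/-- A function `φ : (0,∞) → [1,∞)` of standard Lyapunov form with exponents
`γ, δ > 0`: twice continuously differentiable, `≥ 1`, equal to `x^{-γ}` near `0`
and to `x^δ` near `∞`. -/
def StdLyapunovForm (φ : ℝ → ℝ) (γ δ : ℝ) : Prop :=
  ContDiffOn ℝ 2 φ (Set.Ioi 0) ∧ (∀ x ∈ Set.Ioi (0 : ℝ), 1 ≤ φ x) ∧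
    ∃ x₀ x₁ : ℝ, 0 < x₀ ∧ x₀ < x₁ ∧
      (∀ x ∈ Set.Ioc (0 : ℝ) x₀, φ x = x ^ (-γ)) ∧
      (∀ x ∈ Set.Ici x₁, φ x = x ^ δ)

open Filter Topology Set

/-- Action of the generator on a function that agrees with a power near `x`. -/
theorem fsGen_of_eventuallyEq_rpow {θ κ α β p x : ℝ} {f : ℝ → ℝ} (hx : 0 < x)
    (hf : f =ᶠ[𝓝 x] fun y => y ^ p) :
    fsGen θ κ α β f x =
      x ^ p * (θ * p * (-1 + 2 * (p - 1) / (β - 2)) + θ * κ * p * (1 + 2 * (p - 1) / α) / x) := by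
  have hderiv : ∀ (q : ℝ), ∀ y : ℝ, 0 < y → deriv (fun z : ℝ => z ^ q) y = q * y ^ (q - 1) :=
    fun q y hy => (hasDerivAt_rpow_const (Or.inl hy.ne')).deriv
  have h1 : deriv f =ᶠ[𝓝 x] fun y => p * y ^ (p - 1) := by
    filter_upwards [hf.deriv, lt_mem_nhds hx] with y hy hy0
    rw [hy, hderiv p y hy0]
  have h2 : deriv (deriv f) x = p * ((p - 1) * x ^ (p - 1 - 1)) := by
    rw [h1.deriv_eq, deriv_const_mul_field, hderiv _ x hx]
  rw [fsGen, h2, h1.eq_of_nhds, fsDrift, fsSigma2]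
  simp only [rpow_sub_one hx.ne']
  field_simp
  ring

/-- The generator maps `C²` functions on the half-line to continuous functions. -/
theorem continuousOn_fsGen (θ κ α β : ℝ) {f : ℝ → ℝ} (hf : ContDiffOn ℝ 2 f (Ioi 0)) :
    ContinuousOn (fsGen θ κ α β f) (Ioi 0) := by
  have h1 : ContDiffOn ℝ 1 (deriv f) (Ioi 0) := hf.deriv_of_isOpen isOpen_Ioi (by norm_num)
  have h2 : ContinuousOn (deriv (deriv f)) (Ioi 0) :=
    h1.continuousOn_deriv_of_isOpen isOpen_Ioi le_rfl
  have h3 : Continuous (fsDrift θ κ) := by unfold fsDrift; fun_prop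
  have h4 : Continuous (fsSigma2 θ κ α β) := by unfold fsSigma2; fun_prop
  exact (h3.continuousOn.mul h1.continuousOn).add
    ((continuousOn_const.mul h4.continuousOn).mul h2)

/-- Lyapunov-type condition, Proposition 3.1(1): if `φ` is of
standard Lyapunov form with exponents `0 < γ < α/2 - 1`, `0 < δ < β/2`, then
there are `0 < u < v` and `c, C > 0` with
`(Lφ)(x) ≤ -c φ(x) + C 𝟙_{[u,v]}(x)` for all `x > 0`. -/
theorem fs_lyapunov_condition
    (θ κ α β : ℝ) (hθ : 0 < θ) (hκ : 0 < κ) (hα : 2 < α) (hβ : 2 < β)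
    (γ δ : ℝ) (hγ0 : 0 < γ) (hγ : γ < α / 2 - 1) (hδ0 : 0 < δ) (hδ : δ < β / 2)
    (φ : ℝ → ℝ) (hφ : StdLyapunovForm φ γ δ) :
    ∃ u v c C : ℝ, 0 < u ∧ u < v ∧ 0 < c ∧ 0 < C ∧
      ∀ x ∈ Set.Ioi (0 : ℝ),
        fsGen θ κ α β φ x ≤
          -c * φ x + C * Set.indicator (Set.Icc u v) (fun _ => (1 : ℝ)) x := by
  obtain ⟨hφ2, hφ1, x₀, x₁, hx₀, hx₀₁, hφ₀, hφ₁⟩ := hφ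
  have hα0 : 0 < α := by linarith
  have hβ2 : 0 < β - 2 := by linarith
  set A₁ := θ * δ * (-1 + 2 * (δ - 1) / (β - 2)) with hA₁
  set B₁ := θ * κ * δ * (1 + 2 * (δ - 1) / α) with hB₁
  set A₀ := θ * (-γ) * (-1 + 2 * (-γ - 1) / (β - 2)) with hA₀
  set B₀ := θ * κ * (-γ) * (1 + 2 * (-γ - 1) / α) with hB₀
  have hA₁neg : A₁ < 0 := by
    have : -1 + 2 * (δ - 1) / (β - 2) < 0 := by
      have : 2 * (δ - 1) / (β - 2) < 1 := by rw [div_lt_one hβ2]; linarith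
      linarith
    exact mul_neg_of_pos_of_neg (by positivity) this
  have hA₀pos : 0 < A₀ := by
    have : 0 < 2 * (γ + 1) / (β - 2) := by positivity
    have e : A₀ = θ * γ * (1 + 2 * (γ + 1) / (β - 2)) := by rw [hA₀]; ring
    rw [e]; positivity
  have hB₀neg : B₀ < 0 := by
    have h : 2 * (γ + 1) / α < 1 := by rw [div_lt_one hα0]; linarith
    have e : B₀ = -(θ * κ * γ * (1 - 2 * (γ + 1) / α)) := by rw [hB₀]; ring
    have : 0 < 1 - 2 * (γ + 1) / α := by linarith
    rw [e, neg_lt_zero]; positivity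
  obtain ⟨c, hc⟩ : ∃ c, c = -A₁ / 2 := ⟨_, rfl⟩
  have hc0 : 0 < c := by linarith
  obtain ⟨u, hu⟩ : ∃ u, u = min x₀ (-B₀ / (A₀ + c)) := ⟨_, rfl⟩
  obtain ⟨v, hv⟩ : ∃ v, v = max x₁ (B₁ / c) := ⟨_, rfl⟩
  have hu0 : 0 < u := hu ▸ lt_min hx₀ (div_pos (by linarith) (by linarith))
  have hux : u ≤ x₀ := hu ▸ min_le_left _ _
  have hvx : x₁ ≤ v := hv ▸ le_max_left _ _
  have huB : u ≤ -B₀ / (A₀ + c) := hu ▸ min_le_right _ _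
  have hvB : B₁ / c ≤ v := hv ▸ le_max_right _ _
  have hsub : Icc u v ⊆ Ioi 0 := fun x hx => hu0.trans_le hx.1
  obtain ⟨M, hM⟩ := (isCompact_Icc (a := u) (b := v)).bddAbove_image
    (((continuousOn_fsGen θ κ α β hφ2).add (hφ2.continuousOn.const_smul c)).mono hsub)
  refine ⟨u, v, c, max M 1, hu0, by linarith, hc0, by positivity, fun x hx => ?_⟩
  have hx : 0 < x := hx
  by_cases hxI : x ∈ Icc u v
  · have h : fsGen θ κ α β φ x + c * φ x ≤ M := hM (mem_image_of_mem _ hxI)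
    rw [indicator_of_mem hxI]
    linarith [le_max_left M 1]
  rw [indicator_of_notMem hxI, mul_zero, add_zero]
  rcases lt_or_ge x u with hxu | hxu
  · have hev : φ =ᶠ[𝓝 x] fun y => y ^ (-γ) := by
      filter_upwards [Ioo_mem_nhds hx (hxu.trans_le hux)] with y hy
      exact hφ₀ y ⟨hy.1, hy.2.le⟩
    have hb : A₀ + B₀ / x ≤ -c := by
      have h := hxu.le.trans huB
      rw [le_div_iff₀ (by linarith)] at h
      have : B₀ / x ≤ -(A₀ + c) := by rw [div_le_iff₀ hx]; linarith
      linarith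
    rw [fsGen_of_eventuallyEq_rpow hx hev, hev.eq_of_nhds, mul_comm (-c)]
    exact mul_le_mul_of_nonneg_left hb (rpow_nonneg hx.le _)
  · have hxv : v < x := not_le.mp fun h => hxI ⟨hxu, h⟩
    have hev : φ =ᶠ[𝓝 x] fun y => y ^ δ := by
      filter_upwards [lt_mem_nhds (hvx.trans_lt hxv)] with y hy
      exact hφ₁ y hy.le
    have hb : A₁ + B₁ / x ≤ -c := by
      have h := hvB.trans hxv.le
      rw [div_le_iff₀ hc0] at h
      have : B₁ / x ≤ c := by rw [div_le_iff₀ hx]; linarith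
      linarith
    rw [fsGen_of_eventuallyEq_rpow hx hev, hev.eq_of_nhds, mul_comm (-c)]
    exact mul_le_mul_of_nonneg_left hb (rpow_nonneg hx.le _)
end

section
/- Let θ > 0, κ > 0, α > 2, β > 2, and let 0 < γ′ < α/2 − 1. For ψ(x) = x^{−γ′}, the generator satisfies the exact asymptotics at the left boundary: lim_{x→0⁺} x^{γ′+1}·(Lψ)(x) = −θ·γ′·κ·(1 − 2(γ′+1)/α), and this limit is strictly negative. -/
open Real MeasureTheory Filter

/-- On `(0, ∞)`, `x^{γ+1}` times the generator applied to `x^{-γ}` is an affine function of `x`. -/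
theorem rpow_mul_fsGen_rpow_neg (θ κ α β γ : ℝ) {x : ℝ} (hx : 0 < x) :
    x ^ (γ + 1) * fsGen θ κ α β (fun y : ℝ => y ^ (-γ)) x =
      θ * γ * (x - κ) + θ * γ * (γ + 1) * (2 * x / (β - 2) + 2 * κ / α) := by
  have h1 : deriv (fun y : ℝ => y ^ (-γ)) x = -γ * x ^ (-(γ + 1)) := by
    rw [Real.deriv_rpow_const]
    congr 2
    ring
  have h2 : deriv (deriv fun y : ℝ => y ^ (-γ)) x = γ * (γ + 1) * (x ^ (-(γ + 1)) * x⁻¹) := by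
    have hev : deriv (fun y : ℝ => y ^ (-γ)) =ᶠ[nhds x] fun y => -γ * y ^ (-γ - 1) :=
      Eventually.of_forall fun y => Real.deriv_rpow_const y (-γ)
    rw [hev.deriv_eq, ((Real.hasDerivAt_rpow_const (Or.inl hx.ne')).const_mul (-γ)).deriv,
      Real.rpow_sub_one hx.ne', show -γ - 1 = -(γ + 1) by ring]
    ring
  have hpow : x ^ (γ + 1) * x ^ (-(γ + 1)) = 1 := by
    rw [← Real.rpow_add hx, add_neg_cancel, Real.rpow_zero]
  rw [fsGen, h1, h2, fsDrift, fsSigma2]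
  linear_combination
    (θ * γ * (x - κ) + x * x⁻¹ * (θ * γ * (γ + 1) * (2 * x / (β - 2) + 2 * κ / α))) * hpow +
      θ * γ * (γ + 1) * (2 * x / (β - 2) + 2 * κ / α) * mul_inv_cancel₀ hx.ne'

/-- for `ψ(x) = x^{-γ'}` with `0 < γ' < α/2 - 1`,
`x^{γ'+1} (Lψ)(x) → -θ γ' κ (1 - 2(γ'+1)/α)` as `x → 0⁺`, and this limit is
strictly negative. -/
theorem fs_generator_asymptotics_at_zero
    (θ κ α β : ℝ) (hθ : 0 < θ) (hκ : 0 < κ) (hα : 2 < α) (hβ : 2 < β)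
    (γ' : ℝ) (hγ'0 : 0 < γ') (hγ' : γ' < α / 2 - 1) :
    Tendsto
      (fun x : ℝ => x ^ (γ' + 1) * fsGen θ κ α β (fun y : ℝ => y ^ (-γ')) x)
      (nhdsWithin 0 (Set.Ioi 0))
      (nhds (-(θ * γ' * κ * (1 - 2 * (γ' + 1) / α)))) ∧
    -(θ * γ' * κ * (1 - 2 * (γ' + 1) / α)) < 0 := by
  refine ⟨?_, ?_⟩
  · have hlim : Tendsto
        (fun x : ℝ => θ * γ' * (x - κ) + θ * γ' * (γ' + 1) * (2 * x / (β - 2) + 2 * κ / α))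
        (nhdsWithin 0 (Set.Ioi 0)) (nhds (-(θ * γ' * κ * (1 - 2 * (γ' + 1) / α)))) := by
      refine (Continuous.tendsto' (by fun_prop) _ _ ?_).mono_left nhdsWithin_le_nhds
      ring
    refine hlim.congr' ?_
    filter_upwards [self_mem_nhdsWithin] with x hx
    exact (rpow_mul_fsGen_rpow_neg θ κ α β γ' hx).symm
  · have h : 2 * (γ' + 1) / α < 1 := by
      rw [div_lt_one (by linarith)]
      linarith
    have : 0 < 1 - 2 * (γ' + 1) / α := by linarith
    exact neg_neg_of_pos (by positivity)
end

section
/- Let θ > 0, κ > 0, α > 2, β > 2, and let 0 < δ′ < β/2. For ψ(x) = x^{δ′}, the generator satisfies the exact asymptotics at infinity: lim_{x→∞} x^{−δ′}·(Lψ)(x) = −θ·δ′·(1 − 2(δ′−1)/(β−2)), and this limit is strictly negative. -/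
open Real MeasureTheory Filter

/-- The generator on a power function, scaled by the inverse power, is affine in `x⁻¹`. -/
theorem rpow_neg_mul_fsGen_rpow (θ κ α β p : ℝ) {x : ℝ} (hx : 0 < x) :
    x ^ (-p) * fsGen θ κ α β (fun y : ℝ => y ^ p) x =
      -(θ * p * (1 - 2 * (p - 1) / (β - 2))) +
        θ * κ * p * (1 + 2 * (p - 1) / α) * x⁻¹ := by
  have h1 : ∀ y : ℝ, 0 < y → deriv (fun y : ℝ => y ^ p) y = p * y ^ (p - 1) := fun y hy =>
    (Real.hasDerivAt_rpow_const (Or.inl hy.ne')).deriv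
  have h2 : deriv (deriv fun y : ℝ => y ^ p) x = p * ((p - 1) * x ^ (p - 1 - 1)) := by
    have heq : deriv (fun y : ℝ => y ^ p) =ᶠ[nhds x] fun y => p * y ^ (p - 1) := by
      filter_upwards [lt_mem_nhds hx] with y hy using h1 y hy
    rw [heq.deriv_eq]
    exact ((Real.hasDerivAt_rpow_const (Or.inl hx.ne')).const_mul p).deriv
  rw [fsGen, fsDrift, fsSigma2, h1 x hx, h2, Real.rpow_sub_one hx.ne' (p - 1),
    Real.rpow_sub_one hx.ne' p, Real.rpow_neg hx.le]
  have hp : x ^ p ≠ 0 := (Real.rpow_pos_of_pos hx p).ne'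
  generalize x ^ p = q at hp ⊢
  simp only [div_eq_mul_inv]
  field_simp
  ring

/-- for `ψ(x) = x^{δ'}` with `0 < δ' < β/2`,
`x^{-δ'} (Lψ)(x) → -θ δ' (1 - 2(δ'-1)/(β-2))` as `x → ∞`, and this limit is
strictly negative. -/
theorem fs_generator_asymptotics_at_infinity
    (θ κ α β : ℝ) (hθ : 0 < θ) (hκ : 0 < κ) (hα : 2 < α) (hβ : 2 < β)
    (δ' : ℝ) (hδ'0 : 0 < δ') (hδ' : δ' < β / 2) :
    Tendsto
      (fun x : ℝ => x ^ (-δ') * fsGen θ κ α β (fun y : ℝ => y ^ δ') x)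
      atTop
      (nhds (-(θ * δ' * (1 - 2 * (δ' - 1) / (β - 2))))) ∧
    -(θ * δ' * (1 - 2 * (δ' - 1) / (β - 2))) < 0 := by
  constructor
  · have hlim := (tendsto_inv_atTop_zero (𝕜 := ℝ)).const_mul
      (θ * κ * δ' * (1 + 2 * (δ' - 1) / α))
    have hlim' := hlim.const_add (-(θ * δ' * (1 - 2 * (δ' - 1) / (β - 2))))
    rw [mul_zero, add_zero] at hlim'
    refine hlim'.congr' ?_
    filter_upwards [eventually_gt_atTop 0] with x hx
    exact (rpow_neg_mul_fsGen_rpow θ κ α β δ' hx).symm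
  · have h : 2 * (δ' - 1) / (β - 2) < 1 := by
      rw [div_lt_one (by linarith)]
      linarith
    exact neg_lt_zero.mpr (mul_pos (mul_pos hθ hδ'0) (sub_pos.mpr h))
end

section
/- (Hölder interpolation of weighted variation norms, equations (46)+(52).) Let γ, δ, γ′, δ′ > 0, let m ≥ 1 be an integer and let ε > 0. Define Φ(x) = Σ_{j=1}^m (x_j^{−γ} + x_j^{δ}) and Ψ(x) = Σ_{j=1}^m (x_j^{−γ′} + x_j^{δ′}) for x = (x₁, …, x_m) ∈ (0,∞)^m. Then there exist a constant C > 0 and exponents p, q > 1 with 1/p + 1/q = 1 such that for every finite nonnegative measure ν on (0,∞)^m: ∫ Φ dν ≤ C · (∫ Ψ dν)^{1/p} · (∫ Φ^{1+ε} dν)^{1/q}. -/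
open Real MeasureTheory

theorem one_le_rpow_neg_add_rpow {x a b : ℝ} (hx : 0 < x) (ha : 0 ≤ a) (hb : 0 ≤ b) :
    1 ≤ x ^ (-a) + x ^ b := by
  rcases le_total x 1 with h | h
  · linarith [one_le_rpow_of_pos_of_le_one_of_nonpos hx h (neg_nonpos.mpr ha), rpow_nonneg hx.le b]
  · linarith [one_le_rpow h hb, rpow_nonneg hx.le (-a)]

theorem one_le_sum_rpow_neg_add_rpow {ι : Type*} [Fintype ι] [Nonempty ι] {x : ι → ℝ} {a b : ℝ}
    (hx : ∀ j, 0 < x j) (ha : 0 ≤ a) (hb : 0 ≤ b) :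
    1 ≤ ∑ j, ((x j) ^ (-a) + (x j) ^ b) := by
  obtain ⟨i⟩ := ‹Nonempty ι›
  refine (one_le_rpow_neg_add_rpow (hx i) ha hb).trans ?_
  exact Finset.single_le_sum (f := fun j => (x j) ^ (-a) + (x j) ^ b)
    (fun j _ => add_nonneg (rpow_nonneg (hx j).le _) (rpow_nonneg (hx j).le _))
    (Finset.mem_univ i)

/-- Hölder interpolation of weighted variation norms, equations
(46)+(52): with `Φ(x) = Σⱼ (xⱼ^{-γ} + xⱼ^δ)` and `Ψ(x) = Σⱼ (xⱼ^{-γ'} + xⱼ^{δ'})`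
on `(0,∞)^m`, there exist `C > 0` and conjugate exponents `p, q > 1` such that
for every finite nonnegative measure `ν` on `(0,∞)^m`,
`∫ Φ dν ≤ C (∫ Ψ dν)^{1/p} (∫ Φ^{1+ε} dν)^{1/q}`. -/
theorem holder_interpolation_weighted_norms
    (γ δ γ' δ' ε : ℝ) (hγ : 0 < γ) (hδ : 0 < δ) (hγ' : 0 < γ') (hδ' : 0 < δ')
    (hε : 0 < ε) (m : ℕ) (hm : 1 ≤ m) :
    ∃ C p q : ℝ, 0 < C ∧ 1 < p ∧ 1 < q ∧ 1 / p + 1 / q = 1 ∧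
      ∀ ν : Measure (Fin m → ℝ), IsFiniteMeasure ν →
        (∫⁻ x in {x : Fin m → ℝ | ∀ j, 0 < x j},
            ENNReal.ofReal (∑ j, ((x j) ^ (-γ) + (x j) ^ δ)) ∂ν) ≤
          ENNReal.ofReal C *
            (∫⁻ x in {x : Fin m → ℝ | ∀ j, 0 < x j},
                ENNReal.ofReal (∑ j, ((x j) ^ (-γ') + (x j) ^ δ')) ∂ν) ^ (1 / p) *
            (∫⁻ x in {x : Fin m → ℝ | ∀ j, 0 < x j},
                ENNReal.ofReal
                  ((∑ j, ((x j) ^ (-γ) + (x j) ^ δ)) ^ (1 + ε)) ∂ν) ^ (1 / q) := by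
  have hpq : ((1 + ε) / ε).HolderConjugate (1 + ε) := by
    rw [Real.holderConjugate_iff]
    refine ⟨by rw [lt_div_iff₀ hε]; linarith, ?_⟩
    field_simp
    ring
  refine ⟨1, (1 + ε) / ε, 1 + ε, one_pos, hpq.lt, hpq.symm.lt, ?_, fun ν _ => ?_⟩
  · simpa only [one_div] using hpq.inv_add_inv_eq_one
  have : Nonempty (Fin m) := ⟨⟨0, hm⟩⟩
  have hS : MeasurableSet {x : Fin m → ℝ | ∀ j, 0 < x j} := by
    rw [Set.ofPred_forall]
    exact MeasurableSet.iInter fun j => measurableSet_lt measurable_const (measurable_pi_apply j)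
  have hΦ : Measurable fun x : Fin m → ℝ =>
      ENNReal.ofReal (∑ j, ((x j) ^ (-γ) + (x j) ^ δ)) := by
    fun_prop
  have key := ENNReal.lintegral_mul_le_Lp_mul_Lq
    (ν.restrict {x : Fin m → ℝ | ∀ j, 0 < x j}) hpq
    (aemeasurable_const (b := 1)) hΦ.aemeasurable
  simp only [Pi.mul_apply, one_mul, ENNReal.one_rpow] at key
  rw [ENNReal.ofReal_one, one_mul]
  refine key.trans ?_
  gcongr ?_ ^ _ * ?_ ^ _
  · refine setLIntegral_mono' hS fun x hx => ?_
    exact ENNReal.one_le_ofReal.mpr (one_le_sum_rpow_neg_add_rpow hx hγ'.le hδ'.le)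
  · refine setLIntegral_mono' hS fun x hx => ?_
    rw [ENNReal.ofReal_rpow_of_nonneg
      (zero_le_one.trans (one_le_sum_rpow_neg_add_rpow hx hγ.le hδ.le)) (by positivity)]
end
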